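/- Let G be a finite group of order 27 which is not commutative and in which g³ = 1 for every g ∈ G (the extraspecial 3-group of order 27 and exponent 3). Then G acts freely and smoothly on S⁵ × S⁵: there exists a group homomorphism ρ from G to the group of diffeomorphisms of S⁵ × S⁵ such that ρ(g)(x) ≠ x for every g ≠ 1 and every point x. -/

import Mathlib

open scoped Manifold
open Module

noncomputable section

instance : Fact (finrank ℝ (EuclideanSpace ℂ (Fin 3)) = 5 + 1) := ⟨by
  have h1 := Module.finrank_mul_finrank ℝ ℂ (EuclideanSpace ℂ (Fin 3))
  rw [← h1, finrank_euclideanSpace_fin, Complex.finrank_real_complex]⟩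

open ComplexConjugate

/-! ### Moving frames for the orthogonal complement of a unit vector -/

section Frame

variable {E : Type*} [NormedAddCommGroup E] [InnerProductSpace ℂ E]

/-- The standard Hermitian form on `ℂ × E`. -/
def hermitianForm (p q : ℂ × E) : ℂ := conj p.1 * q.1 + inner ℂ p.2 q.2

/-- For a unit vector `u` with `u.1 ≠ -1`, this is the restriction to `0 × E` of the complex
reflection of `ℂ × E` that maps `(-1, 0)` to `u`. -/
def orthFrame (u : ℂ × E) (v : E) : ℂ × E :=
  (-(inner ℂ u.2 v * (1 + u.1) / (1 + conj u.1)), v - (inner ℂ u.2 v / (1 + conj u.1)) • u.2)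

/-- On the orthogonal complement of `u`, this is the inverse of `orthFrame u`. -/
def orthCoframe (u w : ℂ × E) : E := w.2 - (w.1 / (1 + u.1)) • u.2

theorem one_add_conj_ne_zero {z : ℂ} (hz : 1 + z ≠ 0) : 1 + conj z ≠ 0 := by
  intro h
  apply hz
  simpa using congrArg conj h

theorem orthCoframe_orthFrame {u : ℂ × E} (hu : 1 + u.1 ≠ 0) (v : E) :
    orthCoframe u (orthFrame u v) = v := by
  have hu' := one_add_conj_ne_zero hu
  have h : -(inner ℂ u.2 v * (1 + u.1) / (1 + conj u.1)) / (1 + u.1) =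
      -(inner ℂ u.2 v / (1 + conj u.1)) := by
    field_simp
  simp [orthCoframe, orthFrame, h]

theorem orthFrame_orthCoframe {u w : ℂ × E} (hu : 1 + u.1 ≠ 0) (hu1 : hermitianForm u u = 1)
    (hw : hermitianForm u w = 0) : orthFrame u (orthCoframe u w) = w := by
  have hu' := one_add_conj_ne_zero hu
  have h : inner ℂ u.2 (orthCoframe u w) = -(w.1 * (1 + conj u.1) / (1 + u.1)) := by
    have h1 : inner ℂ u.2 u.2 = 1 - conj u.1 * u.1 := by
      rw [← hu1, hermitianForm]; ring
    have h2 : inner ℂ u.2 w.2 = - (conj u.1 * w.1) := by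
      rw [hermitianForm] at hw; linear_combination hw
    rw [orthCoframe, inner_sub_right, inner_smul_right, h1, h2]
    field_simp
    ring
  have h3 : -(w.1 * (1 + conj u.1) / (1 + u.1)) / (1 + conj u.1) = -(w.1 / (1 + u.1)) := by
    field_simp
  ext1
  · simp only [orthFrame, h]
    field_simp
  · simp only [orthFrame, h, h3]
    simp only [orthCoframe]
    module

theorem hermitianForm_orthFrame {u : ℂ × E} (hu : 1 + u.1 ≠ 0) (hu1 : hermitianForm u u = 1)
    (v : E) : hermitianForm u (orthFrame u v) = 0 := by
  have hu' := one_add_conj_ne_zero hu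
  have h1 : inner ℂ u.2 u.2 = 1 - conj u.1 * u.1 := by
    rw [← hu1, hermitianForm]; ring
  simp only [hermitianForm, orthFrame, inner_sub_right, inner_smul_right, h1]
  field_simp
  ring

theorem hermitianForm_orthFrame_self {u : ℂ × E} (hu : 1 + u.1 ≠ 0)
    (hu1 : hermitianForm u u = 1) (v : E) :
    hermitianForm (orthFrame u v) (orthFrame u v) = inner ℂ v v := by
  have hu' := one_add_conj_ne_zero hu
  have h1 : inner ℂ u.2 u.2 = 1 - conj u.1 * u.1 := by
    rw [← hu1, hermitianForm]; ring
  simp only [hermitianForm, orthFrame, inner_sub_right, inner_sub_left, inner_smul_right,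
    inner_smul_left, h1, map_neg, map_div₀, map_mul, map_add, map_one, Complex.conj_conj,
    inner_conj_symm]
  rw [← inner_conj_symm v u.2]
  field_simp
  ring

end Frame

/-! ### Representations of the Heisenberg group over the field with three elements -/

/-- The nontrivial cubic root of unity in the upper half plane. -/
def cubicRoot : ℂ := ⟨-1 / 2, √3 / 2⟩

/-- The additive character of the integers modulo `3` with value `cubicRoot` at `1`. -/
def cubicChar : Fin 3 → ℂ := ![1, cubicRoot, conj cubicRoot]

theorem cubicRoot_mul_self : cubicRoot * cubicRoot = conj cubicRoot := by
  have h : √3 * √3 = 3 := Real.mul_self_sqrt (by norm_num)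
  apply Complex.ext <;> simp [cubicRoot] <;> linarith

theorem cubicRoot_mul_conj : cubicRoot * conj cubicRoot = 1 := by
  have h : √3 * √3 = 3 := Real.mul_self_sqrt (by norm_num)
  apply Complex.ext <;> simp [cubicRoot] <;> linarith

theorem cubicRoot_add_conj : cubicRoot + conj cubicRoot = -1 := by
  apply Complex.ext <;> norm_num [cubicRoot]

theorem cubicChar_add (i j : Fin 3) : cubicChar (i + j) = cubicChar i * cubicChar j := by
  have h1 := cubicRoot_mul_self
  have h2 := cubicRoot_mul_conj
  have h3 := congrArg conj h1
  simp only [map_mul, Complex.conj_conj] at h3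
  fin_cases i <;> fin_cases j <;> simp [cubicChar, h1, h2, h3, mul_comm (conj cubicRoot) cubicRoot]

theorem conj_cubicChar (i : Fin 3) : conj (cubicChar i) = cubicChar (-i) := by
  fin_cases i <;> simp [cubicChar]

@[simp]
theorem cubicChar_zero : cubicChar 0 = 1 := rfl

theorem cubicChar_eq_one {i : Fin 3} (h : cubicChar i = 1) : i = 0 := by
  have h3 : √3 ≠ 0 := by positivity
  fin_cases i
  · rfl
  · have := congrArg Complex.im h
    simp [cubicChar, cubicRoot, h3] at this
  · have := congrArg Complex.im h
    simp [cubicChar, cubicRoot, h3] at this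

theorem conj_cubicChar_mul_self (i : Fin 3) : conj (cubicChar i) * cubicChar i = 1 := by
  rw [conj_cubicChar, ← cubicChar_add, neg_add_cancel, cubicChar_zero]

/-- Multiplication of the Heisenberg group over the integers modulo `3`. -/
def heisenbergMul (s t : Fin 3 × Fin 3 × Fin 3) : Fin 3 × Fin 3 × Fin 3 :=
  (s.1 + t.1, s.2.1 + t.2.1, s.2.2 + t.2.2 + s.1 * t.2.1)

/-- The Schrödinger representation of the Heisenberg group on `ℂ³`. -/
def schrodinger (t : Fin 3 × Fin 3 × Fin 3) (x : EuclideanSpace ℂ (Fin 3)) :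
    EuclideanSpace ℂ (Fin 3) :=
  WithLp.toLp 2 fun n => cubicChar (t.2.2 + t.2.1 * n) * x (n + t.1)

/-- A representation of the Heisenberg group on `ℂ × ℂ³` with trivial action of the centre. -/
def shiftRep (t : Fin 3 × Fin 3 × Fin 3) (w : ℂ × EuclideanSpace ℂ (Fin 3)) :
    ℂ × EuclideanSpace ℂ (Fin 3) :=
  (cubicChar (-t.1) * w.1, WithLp.toLp 2 fun n => cubicChar (-t.2.1) * w.2 (n + t.1))

/-- A quadratic map from `ℂ³` to `ℂ × ℂ³` that maps the unit sphere to the unit sphere and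
intertwines `schrodinger` with `shiftRep`. -/
def equivariantQuadratic (x : EuclideanSpace ℂ (Fin 3)) : ℂ × EuclideanSpace ℂ (Fin 3) :=
  (∑ n, cubicChar n * (x n * starRingEnd ℂ (x n)),
    WithLp.toLp 2 fun n => (√3 : ℂ) * (x n * starRingEnd ℂ (x (n + 1))))

open scoped Fin.CommRing in
theorem schrodinger_heisenbergMul (s t : Fin 3 × Fin 3 × Fin 3)
    (x : EuclideanSpace ℂ (Fin 3)) :
    schrodinger (heisenbergMul s t) x = schrodinger s (schrodinger t x) := by
  ext n
  have h : s.2.2 + t.2.2 + s.1 * t.2.1 + (s.2.1 + t.2.1) * n =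
      s.2.2 + s.2.1 * n + (t.2.2 + t.2.1 * (n + s.1)) := by
    ring
  simp only [schrodinger, heisenbergMul, ← mul_assoc, ← cubicChar_add, h, add_assoc n]

theorem shiftRep_heisenbergMul (s t : Fin 3 × Fin 3 × Fin 3)
    (w : ℂ × EuclideanSpace ℂ (Fin 3)) :
    shiftRep (heisenbergMul s t) w = shiftRep s (shiftRep t w) := by
  simp only [shiftRep, heisenbergMul, ← mul_assoc, ← cubicChar_add, neg_add, add_assoc]

theorem schrodinger_zero (x : EuclideanSpace ℂ (Fin 3)) : schrodinger 0 x = x := by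
  ext n
  simp [schrodinger]

theorem shiftRep_zero (w : ℂ × EuclideanSpace ℂ (Fin 3)) : shiftRep 0 w = w := by
  ext n <;> simp [shiftRep]

theorem inner_schrodinger (t : Fin 3 × Fin 3 × Fin 3) (x : EuclideanSpace ℂ (Fin 3)) :
    inner ℂ (schrodinger t x) (schrodinger t x) = inner ℂ x x := by
  simp only [PiLp.inner_apply, RCLike.inner_apply, schrodinger, map_mul]
  rw [← Equiv.sum_comp (Equiv.addRight t.1) (fun n => x n * starRingEnd ℂ (x n))]
  refine Finset.sum_congr rfl fun n _ => ?_
  simp only [Equiv.coe_addRight]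
  linear_combination x (n + t.1) * conj (x (n + t.1)) *
    conj_cubicChar_mul_self (t.2.2 + t.2.1 * n)

theorem hermitianForm_shiftRep (t : Fin 3 × Fin 3 × Fin 3)
    (p q : ℂ × EuclideanSpace ℂ (Fin 3)) :
    hermitianForm (shiftRep t p) (shiftRep t q) = hermitianForm p q := by
  simp only [hermitianForm, PiLp.inner_apply, RCLike.inner_apply, shiftRep, map_mul]
  rw [← Equiv.sum_comp (Equiv.addRight t.1) (fun n => q.2 n * starRingEnd ℂ (p.2 n))]
  congr 1
  · linear_combination conj p.1 * q.1 * conj_cubicChar_mul_self (-t.1)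
  · refine Finset.sum_congr rfl fun n _ => ?_
    simp only [Equiv.coe_addRight]
    linear_combination q.2 (n + t.1) * conj (p.2 (n + t.1)) * conj_cubicChar_mul_self (-t.2.1)

theorem equivariantQuadratic_schrodinger (t : Fin 3 × Fin 3 × Fin 3)
    (x : EuclideanSpace ℂ (Fin 3)) :
    equivariantQuadratic (schrodinger t x) = shiftRep t (equivariantQuadratic x) := by
  ext n
  · simp only [equivariantQuadratic, shiftRep, schrodinger, map_mul]
    rw [Finset.mul_sum, ← Equiv.sum_comp (Equiv.addRight t.1)
      (fun n => cubicChar (-t.1) * (cubicChar n * (x n * starRingEnd ℂ (x n))))]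
    refine Finset.sum_congr rfl fun n _ => ?_
    have h : cubicChar (-t.1) * cubicChar (n + t.1) = cubicChar n := by
      rw [← cubicChar_add, add_comm n, neg_add_cancel_left]
    simp only [Equiv.coe_addRight, ← mul_assoc, h]
    linear_combination cubicChar n * x (n + t.1) * conj (x (n + t.1)) *
      conj_cubicChar_mul_self (t.2.2 + t.2.1 * n)
  · simp only [equivariantQuadratic, shiftRep, schrodinger, map_mul]
    have h : cubicChar (t.2.2 + t.2.1 * n) * conj (cubicChar (t.2.2 + t.2.1 * (n + 1))) =
        cubicChar (-t.2.1) := by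
      rw [conj_cubicChar, ← cubicChar_add]
      generalize t.2.1 = b; generalize t.2.2 = c
      congr 1
      revert b c n; decide
    rw [← h, add_right_comm n 1 t.1]
    ring

theorem hermitianForm_equivariantQuadratic (x : EuclideanSpace ℂ (Fin 3)) :
    hermitianForm (equivariantQuadratic x) (equivariantQuadratic x) = inner ℂ x x ^ 2 := by
  have h : (√3 : ℂ) * √3 = 3 := by
    exact_mod_cast congrArg Complex.ofReal (Real.mul_self_sqrt (show (0 : ℝ) ≤ 3 by norm_num))
  have h1 := cubicRoot_mul_self
  have h2 := cubicRoot_mul_conj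
  have h3 := congrArg conj h1
  have h4 := cubicRoot_add_conj
  simp only [map_mul, Complex.conj_conj] at h3
  simp only [hermitianForm, PiLp.inner_apply, RCLike.inner_apply, equivariantQuadratic, map_mul,
    Fin.sum_univ_three, cubicChar, map_add, Complex.conj_conj, Complex.conj_ofReal]
  simp only [Matrix.cons_val, map_one, show (1 : Fin 3) + 1 = 2 from rfl,
    show (2 : Fin 3) + 1 = 0 from rfl, zero_add, Complex.conj_conj]
  generalize x 0 = a; generalize x 1 = b; generalize x 2 = c
  set A := a * starRingEnd ℂ a
  set B := b * starRingEnd ℂ b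
  set C := c * starRingEnd ℂ c
  linear_combination
    (B ^ 2 + C ^ 2) * h2 + (A * B + A * C) * h4 + B * C * (h1 + h3 + h4) + (A * B + B * C + C * A) * h

theorem one_add_equivariantQuadratic_ne_zero {x : EuclideanSpace ℂ (Fin 3)}
    (hx : inner ℂ x x = (1 : ℂ)) : 1 + (equivariantQuadratic x).1 ≠ 0 := by
  intro h
  have h1 := congrArg Complex.re h
  rw [PiLp.inner_apply] at hx
  have h2 := congrArg Complex.re hx
  simp only [RCLike.inner_apply, Fin.sum_univ_three, Complex.mul_conj, Complex.add_re,
    Complex.ofReal_re, Complex.one_re] at h2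
  simp [equivariantQuadratic, Fin.sum_univ_three, cubicChar, cubicRoot, Complex.mul_conj] at h1
  have h0 := Complex.normSq_nonneg (x 0)
  linarith

/-- The action of the Heisenberg group on `ℂ³ × ℂ³` that is built from `schrodinger` on the base
and `shiftRep` on the complement of `equivariantQuadratic`. -/
def twistedAct (t : Fin 3 × Fin 3 × Fin 3)
    (y : EuclideanSpace ℂ (Fin 3) × EuclideanSpace ℂ (Fin 3)) :
    EuclideanSpace ℂ (Fin 3) × EuclideanSpace ℂ (Fin 3) :=
  (schrodinger t y.1, orthCoframe (equivariantQuadratic (schrodinger t y.1))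
    (shiftRep t (orthFrame (equivariantQuadratic y.1) y.2)))

theorem hermitianForm_equivariantQuadratic_of_inner {x : EuclideanSpace ℂ (Fin 3)}
    (hx : inner ℂ x x = (1 : ℂ)) :
    hermitianForm (equivariantQuadratic x) (equivariantQuadratic x) = 1 := by
  rw [hermitianForm_equivariantQuadratic, hx, one_pow]

theorem orthFrame_twistedAct (t : Fin 3 × Fin 3 × Fin 3)
    {y : EuclideanSpace ℂ (Fin 3) × EuclideanSpace ℂ (Fin 3)} (hy : inner ℂ y.1 y.1 = (1 : ℂ)) :
    orthFrame (equivariantQuadratic (twistedAct t y).1) (twistedAct t y).2 =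
      shiftRep t (orthFrame (equivariantQuadratic y.1) y.2) := by
  have ht : inner ℂ (schrodinger t y.1) (schrodinger t y.1) = (1 : ℂ) := by
    rw [inner_schrodinger, hy]
  refine orthFrame_orthCoframe (one_add_equivariantQuadratic_ne_zero ht)
    (hermitianForm_equivariantQuadratic_of_inner ht) ?_
  rw [twistedAct, equivariantQuadratic_schrodinger, hermitianForm_shiftRep,
    hermitianForm_orthFrame (one_add_equivariantQuadratic_ne_zero hy)
      (hermitianForm_equivariantQuadratic_of_inner hy)]

theorem twistedAct_heisenbergMul (s t : Fin 3 × Fin 3 × Fin 3)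
    {y : EuclideanSpace ℂ (Fin 3) × EuclideanSpace ℂ (Fin 3)} (hy : inner ℂ y.1 y.1 = (1 : ℂ)) :
    twistedAct (heisenbergMul s t) y = twistedAct s (twistedAct t y) := by
  rw [twistedAct.eq_def s, orthFrame_twistedAct t hy]
  simp only [twistedAct, schrodinger_heisenbergMul, shiftRep_heisenbergMul]

theorem twistedAct_zero {y : EuclideanSpace ℂ (Fin 3) × EuclideanSpace ℂ (Fin 3)}
    (hy : inner ℂ y.1 y.1 = (1 : ℂ)) : twistedAct 0 y = y := by
  rw [twistedAct, schrodinger_zero, shiftRep_zero,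
    orthCoframe_orthFrame (one_add_equivariantQuadratic_ne_zero hy)]

theorem inner_twistedAct_snd (t : Fin 3 × Fin 3 × Fin 3)
    {y : EuclideanSpace ℂ (Fin 3) × EuclideanSpace ℂ (Fin 3)} (hy : inner ℂ y.1 y.1 = (1 : ℂ)) :
    inner ℂ (twistedAct t y).2 (twistedAct t y).2 = (inner ℂ y.2 y.2 : ℂ) := by
  have ht : inner ℂ (twistedAct t y).1 (twistedAct t y).1 = (1 : ℂ) := by
    rw [twistedAct, inner_schrodinger, hy]
  rw [← hermitianForm_orthFrame_self (one_add_equivariantQuadratic_ne_zero ht)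
      (hermitianForm_equivariantQuadratic_of_inner ht), orthFrame_twistedAct t hy,
    hermitianForm_shiftRep,
    hermitianForm_orthFrame_self (one_add_equivariantQuadratic_ne_zero hy)
      (hermitianForm_equivariantQuadratic_of_inner hy)]

theorem eq_zero_of_mul_eq_self {c a : ℂ} (hc : c ≠ 1) (h : c * a = a) : a = 0 := by
  by_contra ha
  exact hc (mul_right_cancel₀ ha (h.trans (one_mul _).symm))

/-- Outside the centre, the fixed space of `shiftRep t` is at most one-dimensional. -/
theorem eq_zero_of_shiftRep_eq {t : Fin 3 × Fin 3 × Fin 3} (ht : t.1 ≠ 0 ∨ t.2.1 ≠ 0)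
    {u w : ℂ × EuclideanSpace ℂ (Fin 3)} (hu : shiftRep t u = u) (hw : shiftRep t w = w)
    (huw : hermitianForm u w = 0) : u = 0 ∨ w = 0 := by
  obtain ⟨i, j, k⟩ := t
  simp only [shiftRep, Prod.ext_iff, PiLp.ext_iff] at hu hw
  obtain ⟨hu0, hu⟩ := hu
  obtain ⟨hw0, hw⟩ := hw
  simp only [hermitianForm, PiLp.inner_apply, RCLike.inner_apply] at huw
  by_cases hi : i = 0
  · subst hi
    have hj : cubicChar (-j) ≠ 1 := fun h => by simpa using And.intro ht (cubicChar_eq_one h)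
    simp only [add_zero] at hu hw
    have hu' : u.2 = 0 := PiLp.ext fun n => eq_zero_of_mul_eq_self hj (hu n)
    have hw' : w.2 = 0 := PiLp.ext fun n => eq_zero_of_mul_eq_self hj (hw n)
    simp only [hu', hw', PiLp.zero_apply, zero_mul, Finset.sum_const_zero, add_zero, mul_eq_zero,
      map_eq_zero] at huw
    exact huw.imp (fun h => Prod.ext h hu') (fun h => Prod.ext h hw')
  · have hi' : cubicChar (-i) ≠ 1 := fun h => hi (by simpa using cubicChar_eq_one h)
    have hu' : u.1 = 0 := eq_zero_of_mul_eq_self hi' hu0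
    have hw' : w.1 = 0 := eq_zero_of_mul_eq_self hi' hw0
    have hc := conj_cubicChar_mul_self (-j)
    have hc0 : cubicChar (-j) ≠ 0 := right_ne_zero_of_mul (hc.trans_ne one_ne_zero)
    have hper : ∀ n, w.2 (n + i) * conj (u.2 (n + i)) = w.2 n * conj (u.2 n) := fun n => by
      rw [← hu n, ← hw n, map_mul]
      linear_combination -(w.2 (n + i) * conj (u.2 (n + i))) * hc
    have hzero : ∀ v : EuclideanSpace ℂ (Fin 3), (∀ n, cubicChar (-j) * v (n + i) = v n) →
        v 0 = 0 → v = 0 := by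
      intro v hv h0
      have h1 : v i = 0 := by simpa [h0, hc0] using hv 0
      have h2 : v (i + i) = 0 := by simpa [h1, hc0] using hv i
      ext n
      have : n = 0 ∨ n = i ∨ n = i + i := by
        clear * - hi
        revert n i
        decide
      rcases this with rfl | rfl | rfl <;> assumption
    have hsum : 3 * (w.2 0 * conj (u.2 0)) = 0 := by
      rw [hu', hw', Fin.sum_univ_three, mul_zero, zero_add] at huw
      have h0 := hper 0
      have h1 := hper i
      have : i = 1 ∨ i = 2 := by
        clear * - hi
        revert i
        decide
      rcases this with rfl | rfl
      · change w.2 1 * conj (u.2 1) = _ at h0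
        change w.2 2 * conj (u.2 2) = _ at h1
        linear_combination huw - h1 - 2 * h0
      · change w.2 2 * conj (u.2 2) = _ at h0
        change w.2 1 * conj (u.2 1) = _ at h1
        linear_combination huw - h1 - 2 * h0
    simp only [mul_eq_zero, map_eq_zero, OfNat.ofNat_ne_zero, false_or] at hsum
    exact hsum.symm.imp (fun h => Prod.ext hu' (hzero _ hu h)) (fun h => Prod.ext hw' (hzero _ hw h))

theorem eq_zero_of_twistedAct_eq {t : Fin 3 × Fin 3 × Fin 3}
    {y : EuclideanSpace ℂ (Fin 3) × EuclideanSpace ℂ (Fin 3)} (hy : inner ℂ y.1 y.1 = (1 : ℂ))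
    (hy2 : y.2 ≠ 0) (h : twistedAct t y = y) : t = 0 := by
  have h1 : schrodinger t y.1 = y.1 := congrArg Prod.fst h
  have hq := hermitianForm_equivariantQuadratic_of_inner hy
  have hn := one_add_equivariantQuadratic_ne_zero hy
  by_cases ht : t.1 ≠ 0 ∨ t.2.1 ≠ 0
  · have hu : shiftRep t (equivariantQuadratic y.1) = equivariantQuadratic y.1 := by
      rw [← equivariantQuadratic_schrodinger, h1]
    have hw := orthFrame_twistedAct t hy
    rw [h] at hw
    rcases eq_zero_of_shiftRep_eq ht hu hw.symm (hermitianForm_orthFrame hn hq _) with h0 | h0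
    · rw [h0] at hq
      simp [hermitianForm] at hq
    · have := orthCoframe_orthFrame hn y.2
      rw [h0] at this
      exact absurd (by simpa [orthCoframe] using this.symm) hy2
  · push Not at ht
    obtain ⟨i, j, k⟩ := t
    obtain ⟨rfl, rfl⟩ := ht
    have hx : ∀ n, cubicChar k * y.1 n = y.1 n := fun n => by
      simpa [schrodinger] using congrArg (fun x : EuclideanSpace ℂ (Fin 3) => x n) h1
    have hk : cubicChar k = 1 := by
      by_contra hk
      have : y.1 = 0 := PiLp.ext fun n => eq_zero_of_mul_eq_self hk (hx n)
      simp [this] at hy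
    rw [cubicChar_eq_one hk]
    rfl

theorem contDiff_schrodinger (t : Fin 3 × Fin 3 × Fin 3) {n : WithTop ℕ∞} :
    ContDiff ℝ n (schrodinger t) := by
  refine contDiff_piLp' 2 fun i => ?_
  simp only [schrodinger]
  fun_prop

theorem contDiff_shiftRep (t : Fin 3 × Fin 3 × Fin 3) {n : WithTop ℕ∞} :
    ContDiff ℝ n (shiftRep t) := by
  refine ContDiff.prodMk (by fun_prop) (contDiff_piLp' 2 fun i => ?_)
  fun_prop

theorem contDiff_equivariantQuadratic {n : WithTop ℕ∞} :
    ContDiff ℝ n equivariantQuadratic := by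
  have h (i : Fin 3) : ContDiff ℝ n fun x : EuclideanSpace ℂ (Fin 3) => starRingEnd ℂ (x i) :=
    Complex.conjCLE.contDiff.comp (contDiff_piLp_apply 2)
  refine ContDiff.prodMk (by fun_prop) (contDiff_piLp' 2 fun i => ?_)
  fun_prop

theorem contDiffAt_orthFrame {u : ℂ × EuclideanSpace ℂ (Fin 3)} {v : EuclideanSpace ℂ (Fin 3)}
    (hu : 1 + u.1 ≠ 0) {n : WithTop ℕ∞} :
    ContDiffAt ℝ n (fun y : (ℂ × EuclideanSpace ℂ (Fin 3)) × EuclideanSpace ℂ (Fin 3) =>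
      orthFrame y.1 y.2) (u, v) := by
  have hu' := one_add_conj_ne_zero hu
  have h1 : ContDiffAt ℝ n (fun y : (ℂ × EuclideanSpace ℂ (Fin 3)) × EuclideanSpace ℂ (Fin 3) =>
      inner ℂ y.1.2 y.2) (u, v) := by
    exact ContDiffAt.inner ℂ (by fun_prop) (by fun_prop)
  have h2 : ContDiffAt ℝ n (fun y : (ℂ × EuclideanSpace ℂ (Fin 3)) × EuclideanSpace ℂ (Fin 3) =>
      (1 + conj y.1.1)⁻¹) (u, v) :=
    ContDiffAt.inv (contDiffAt_const.add
      (Complex.conjCLE.contDiff.contDiffAt.comp (u, v) (by fun_prop))) hu'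
  simp only [orthFrame, div_eq_mul_inv]
  exact ContDiffAt.prodMk (by fun_prop) (ContDiffAt.sub (by fun_prop)
    (ContDiffAt.smul (h1.mul h2) (by fun_prop)))

theorem contDiffAt_orthCoframe {u w : ℂ × EuclideanSpace ℂ (Fin 3)}
    (hu : 1 + u.1 ≠ 0) {n : WithTop ℕ∞} :
    ContDiffAt ℝ n
      (fun y : (ℂ × EuclideanSpace ℂ (Fin 3)) × (ℂ × EuclideanSpace ℂ (Fin 3)) =>
        orthCoframe y.1 y.2) (u, w) := by
  have h : ContDiffAt ℝ n
      (fun y : (ℂ × EuclideanSpace ℂ (Fin 3)) × (ℂ × EuclideanSpace ℂ (Fin 3)) =>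
        (1 + y.1.1)⁻¹) (u, w) :=
    ContDiffAt.inv (by fun_prop) hu
  simp only [orthCoframe, div_eq_mul_inv]
  refine ContDiffAt.sub (by fun_prop) (ContDiffAt.smul (ContDiffAt.mul ?_ h) ?_) <;> fun_prop

theorem contDiffAt_twistedAct (t : Fin 3 × Fin 3 × Fin 3)
    {y : EuclideanSpace ℂ (Fin 3) × EuclideanSpace ℂ (Fin 3)} (hy : inner ℂ y.1 y.1 = (1 : ℂ))
    {n : WithTop ℕ∞} : ContDiffAt ℝ n (twistedAct t) y := by
  have ht : inner ℂ (schrodinger t y.1) (schrodinger t y.1) = (1 : ℂ) := by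
    rw [inner_schrodinger, hy]
  have h1 : ContDiffAt ℝ n (fun y : EuclideanSpace ℂ (Fin 3) × EuclideanSpace ℂ (Fin 3) =>
      schrodinger t y.1) y := (contDiff_schrodinger t).contDiffAt.comp y contDiffAt_fst
  have h2 : ContDiffAt ℝ n (fun y : EuclideanSpace ℂ (Fin 3) × EuclideanSpace ℂ (Fin 3) =>
      orthFrame (equivariantQuadratic y.1) y.2) y :=
    (contDiffAt_orthFrame (one_add_equivariantQuadratic_ne_zero hy)).comp y
      ((contDiff_equivariantQuadratic.contDiffAt.comp y contDiffAt_fst).prodMk contDiffAt_snd)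
  have h3 := ContDiffAt.comp y (contDiffAt_orthCoframe
      (w := shiftRep t (orthFrame (equivariantQuadratic y.1) y.2))
      (one_add_equivariantQuadratic_ne_zero ht))
    ((contDiff_equivariantQuadratic.contDiffAt.comp y h1).prodMk
      ((contDiff_shiftRep t).contDiffAt.comp y h2))
  exact ContDiffAt.prodMk h1 h3

/-! ### Groups of order `27` and exponent `3` -/

theorem quotient_center_comm_of_card_eq_prime_cube {G : Type*} [Group G] {p : ℕ}
    [Fact p.Prime] (hcard : Nat.card G = p ^ 3) (x y : G ⧸ Subgroup.center G) :
    x * y = y * x := by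
  have hp : p.Prime := Fact.out
  have : Finite G := Nat.finite_of_card_ne_zero (by rw [hcard]; exact pow_ne_zero _ hp.ne_zero)
  have : Nontrivial G := Finite.one_lt_card_iff_nontrivial.1
    (by rw [hcard]; exact Nat.one_lt_pow (by norm_num) hp.one_lt)
  have : Nontrivial (Subgroup.center G) := (IsPGroup.of_card hcard).center_nontrivial
  have hmul := Subgroup.card_eq_card_quotient_mul_card_subgroup (Subgroup.center G)
  obtain ⟨k, hk3, hk⟩ := (Nat.dvd_prime_pow hp).1
    (hcard ▸ Subgroup.card_subgroup_dvd_card (Subgroup.center G))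
  have hk0 : k ≠ 0 := by
    rintro rfl
    exact (Finite.one_lt_card (α := Subgroup.center G)).ne' (by simpa using hk)
  rw [hcard, hk] at hmul
  have hq : Nat.card (G ⧸ Subgroup.center G) = p ^ (3 - k) := by
    apply Nat.eq_of_mul_eq_mul_right (pow_pos hp.pos k)
    rw [← hmul, ← pow_add, Nat.sub_add_cancel hk3]
  interval_cases k
  · exact absurd rfl hk0
  · exact (IsPGroup.isMulCommutative_of_card_eq_prime_sq hq).is_comm.comm x y
  · have := isCyclic_of_prime_card (p := p) (by simpa using hq)
    have : IsMulCommutative (G ⧸ Subgroup.center G) := IsCyclic.isMulCommutative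
    exact this.is_comm.comm x y
  · have := (Nat.card_eq_one_iff_unique.1 (by simpa using hq)).1
    exact Subsingleton.elim _ _

theorem pow_mul_pow_of_mul_eq {G : Type*} [Group G] {a b c : G} (hab : a * b = b * a * c)
    (hac : Commute a c) (hbc : Commute b c) (n m : ℕ) :
    a ^ n * b ^ m = b ^ m * a ^ n * c ^ (n * m) := by
  have h1 : SemiconjBy a b (b * c) := by
    rw [SemiconjBy, hab, mul_assoc, mul_assoc, hac.eq]
  have h2 : ∀ n, a ^ n * b = b * c ^ n * a ^ n := by
    intro n
    induction n with
    | zero => simp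
    | succ n ih =>
      rw [pow_succ', mul_assoc, ih, ← mul_assoc, ← mul_assoc, h1.eq, mul_assoc b c, pow_succ',
        mul_assoc b, mul_assoc c a, (hac.pow_right n).eq]
      simp only [mul_assoc]
  have h3 : SemiconjBy (a ^ n) b (b * c ^ n) := h2 n
  rw [(h3.pow_right m).eq, (hbc.pow_right n).mul_pow, ← pow_mul, mul_assoc, mul_assoc,
    (hac.pow_pow n (n * m)).eq]

theorem pow_val_add {G : Type*} [Group G] {x : G} (hx : x ^ 3 = 1) (i j : Fin 3) :
    x ^ (i + j).val = x ^ i.val * x ^ j.val := by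
  rw [Fin.val_add, ← pow_add, ← pow_eq_pow_mod _ hx]

theorem pow_val_mul {G : Type*} [Group G] {x : G} (hx : x ^ 3 = 1) (i j : Fin 3) :
    x ^ (i * j).val = x ^ (i.val * j.val) := by
  rw [Fin.val_mul, ← pow_eq_pow_mod _ hx]

theorem eq_zero_of_pow_val_eq_one {G : Type*} [Group G] {x : G} (hx : x ^ 3 = 1) (hx1 : x ≠ 1)
    {i : Fin 3} (hi : x ^ i.val = 1) : i = 0 := by
  have : Fact (Nat.Prime 3) := ⟨Nat.prime_three⟩
  have h := orderOf_dvd_of_pow_eq_one hi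
  rw [orderOf_eq_prime hx hx1] at h
  exact Fin.ext (Nat.eq_zero_of_dvd_of_lt h i.isLt)

theorem mul_mul_mul_eq_of_central {G : Type*} [Group G] {A A' B B' C C' D : G}
    (h : A * B' = B' * A * D) (hC : ∀ g, Commute g C) (hD : ∀ g, Commute g D) :
    B * B' * (A * A') * (C * C' * D) = B * A * C * (B' * A' * C') := by
  calc B * B' * (A * A') * (C * C' * D) = B * (B' * A) * (A' * C * C' * D) := by
        simp only [mul_assoc]
    _ = B * (A * B') * (A' * C * C') := by
        rw [(hD _).eq, h]
        simp only [mul_assoc]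
    _ = B * A * (B' * A' * C) * C' := by simp only [mul_assoc]
    _ = B * A * C * (B' * A' * C') := by
        rw [(hC _).eq]
        simp only [mul_assoc]

open scoped Fin.CommRing in
theorem exists_heisenbergMul_eq_zero (t : Fin 3 × Fin 3 × Fin 3) :
    ∃ r, heisenbergMul r t = 0 ∧ ∀ s, heisenbergMul r s = 0 → s = t := by
  obtain ⟨i, j, k⟩ := t
  refine ⟨(-i, -j, -k + i * j), ?_, ?_⟩
  · simp only [heisenbergMul, neg_add_cancel, Prod.mk_eq_zero, true_and]
    ring
  · rintro ⟨i', j', k'⟩ h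
    simp only [heisenbergMul, Prod.mk_eq_zero] at h
    obtain ⟨hi, hj, hk⟩ := h
    obtain rfl : i = i' := neg_add_eq_zero.1 hi
    obtain rfl : j = j' := neg_add_eq_zero.1 hj
    have : k' = k := by linear_combination hk
    rw [this]

theorem exists_heisenberg_coordinates (G : Type*) [Group G] [Fintype G]
    (hcard : Fintype.card G = 27) (hnonab : ∃ g h : G, g * h ≠ h * g)
    (hexp : ∀ g : G, g ^ 3 = 1) :
    ∃ F : G → Fin 3 × Fin 3 × Fin 3, (∀ g h, F (g * h) = heisenbergMul (F g) (F h)) ∧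
      ∀ g, F g = 0 ↔ g = 1 := by
  have : Fact (Nat.Prime 3) := ⟨Nat.prime_three⟩
  obtain ⟨a, b, hne⟩ := hnonab
  obtain ⟨c, hcz, hab⟩ : ∃ c ∈ Subgroup.center G, a * b = b * a * c := by
    refine ⟨(b * a)⁻¹ * (a * b), ?_, by group⟩
    rw [← QuotientGroup.eq]
    exact quotient_center_comm_of_card_eq_prime_cube (G := G) (p := 3)
      (by rw [Nat.card_eq_fintype_card, hcard]; norm_num) b a
  have hc1 : c ≠ 1 := by
    rintro rfl
    exact hne (by simpa using hab)
  have hc : ∀ g, Commute g c := fun g => Subgroup.mem_center_iff.1 hcz g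
  have hpow := pow_mul_pow_of_mul_eq hab (hc a) (hc b)
  let P : Fin 3 × Fin 3 × Fin 3 → G := fun t => b ^ t.2.1.val * a ^ t.1.val * c ^ t.2.2.val
  have hP : ∀ s t, P (heisenbergMul s t) = P s * P t := by
    intro s t
    simp only [P, heisenbergMul, pow_val_add (hexp _), pow_val_mul (hexp _)]
    exact mul_mul_mul_eq_of_central (hpow _ _) (fun g => (hc g).pow_right _)
      (fun g => (hc g).pow_right _)
  have hker : ∀ t, P t = 1 → t = 0 := by
    rintro ⟨i, j, k⟩ h
    simp only [P] at h
    have hi : i = 0 := by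
      apply eq_zero_of_pow_val_eq_one (hexp c) hc1
      have h1 : b * a ^ i.val * c ^ i.val = a ^ i.val * b := by simpa using (hpow i.val 1).symm
      apply mul_left_cancel (a := b)
      calc b * c ^ i.val = b * (b ^ j.val * a ^ i.val * c ^ k.val) * c ^ i.val := by
            rw [h, mul_one]
        _ = b ^ j.val * (b * a ^ i.val * c ^ i.val) * c ^ k.val := by
            simp only [mul_assoc]
            rw [((Commute.refl b).pow_right j.val).left_comm,
              ((Commute.refl c).pow_pow k.val i.val).eq]
        _ = b ^ j.val * a ^ i.val * c ^ k.val * b := by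
            rw [h1]
            simp only [mul_assoc]
            rw [((hc b).pow_right k.val).eq]
        _ = b * 1 := by rw [h, one_mul, mul_one]
    subst hi
    have hj : j = 0 := by
      apply eq_zero_of_pow_val_eq_one (hexp c) hc1
      have h1 : a * b ^ j.val = b ^ j.val * a * c ^ j.val := by simpa using hpow 1 j.val
      simp only [Fin.val_zero, pow_zero, mul_one] at h
      apply mul_left_cancel (a := a)
      calc a * c ^ j.val = b ^ j.val * c ^ k.val * (a * c ^ j.val) := by rw [h, one_mul]
        _ = b ^ j.val * a * c ^ j.val * c ^ k.val := by
            simp only [mul_assoc]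
            rw [((hc a).pow_right k.val).symm.left_comm,
              ((Commute.refl c).pow_pow k.val j.val).eq]
        _ = a * 1 := by rw [← h1, mul_assoc, h]
    subst hj
    have hk : k = 0 := eq_zero_of_pow_val_eq_one (hexp c) hc1 (by simpa using h)
    rw [hk]
    rfl
  have he0 : P 0 = 1 := by simp [P]
  have hinj : Function.Injective P := by
    intro s t hst
    obtain ⟨r, hrt, hr⟩ := exists_heisenbergMul_eq_zero t
    apply hr
    apply hker
    rw [hP, hst, ← hP, hrt, he0]
  have hbij : Function.Bijective P :=
    (Fintype.bijective_iff_injective_and_card P).2 ⟨hinj, by simp [hcard]⟩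
  let e := Equiv.ofBijective P hbij
  refine ⟨e.symm, fun g h => ?_, fun g => ?_⟩
  · rw [Equiv.symm_apply_eq]
    change _ = P _
    rw [hP]
    exact congrArg₂ _ (e.apply_symm_apply g).symm (e.apply_symm_apply h).symm
  · rw [Equiv.symm_apply_eq]
    exact Eq.congr_right he0

/-! ### The action on the product of spheres -/

theorem inner_self_eq_one_of_mem_sphere {x : EuclideanSpace ℂ (Fin 3)}
    (hx : x ∈ Metric.sphere (0 : EuclideanSpace ℂ (Fin 3)) 1) : inner ℂ x x = (1 : ℂ) := by
  rw [inner_self_eq_norm_sq_to_K, mem_sphere_zero_iff_norm.1 hx]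
  simp

theorem mem_sphere_of_inner_self_eq_one {x : EuclideanSpace ℂ (Fin 3)}
    (hx : inner ℂ x x = (1 : ℂ)) : x ∈ Metric.sphere (0 : EuclideanSpace ℂ (Fin 3)) 1 := by
  rw [inner_self_eq_norm_sq_to_K] at hx
  rw [mem_sphere_zero_iff_norm, ← pow_eq_one_iff_of_nonneg (norm_nonneg x) two_ne_zero]
  exact Complex.ofReal_eq_one.1 ((Complex.ofReal_pow _ _).trans hx)

theorem twistedAct_mem_sphere (t : Fin 3 × Fin 3 × Fin 3)
    {y : EuclideanSpace ℂ (Fin 3) × EuclideanSpace ℂ (Fin 3)}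
    (h1 : y.1 ∈ Metric.sphere (0 : EuclideanSpace ℂ (Fin 3)) 1)
    (h2 : y.2 ∈ Metric.sphere (0 : EuclideanSpace ℂ (Fin 3)) 1) :
    (twistedAct t y).1 ∈ Metric.sphere (0 : EuclideanSpace ℂ (Fin 3)) 1 ∧
      (twistedAct t y).2 ∈ Metric.sphere (0 : EuclideanSpace ℂ (Fin 3)) 1 :=
  have h := inner_self_eq_one_of_mem_sphere h1
  ⟨mem_sphere_of_inner_self_eq_one ((inner_schrodinger t y.1).trans h),
    mem_sphere_of_inner_self_eq_one
      ((inner_twistedAct_snd t h).trans (inner_self_eq_one_of_mem_sphere h2))⟩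

/-- The action `twistedAct` on the product of unit spheres. -/
def sphereAct (t : Fin 3 × Fin 3 × Fin 3)
    (p : Metric.sphere (0 : EuclideanSpace ℂ (Fin 3)) 1 ×
      Metric.sphere (0 : EuclideanSpace ℂ (Fin 3)) 1) :
    Metric.sphere (0 : EuclideanSpace ℂ (Fin 3)) 1 ×
      Metric.sphere (0 : EuclideanSpace ℂ (Fin 3)) 1 :=
  (⟨(twistedAct t (p.1, p.2)).1, (twistedAct_mem_sphere t (y := (p.1, p.2)) p.1.2 p.2.2).1⟩,
    ⟨(twistedAct t (p.1, p.2)).2, (twistedAct_mem_sphere t (y := (p.1, p.2)) p.1.2 p.2.2).2⟩)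

theorem sphereAct_heisenbergMul (s t : Fin 3 × Fin 3 × Fin 3)
    (p : Metric.sphere (0 : EuclideanSpace ℂ (Fin 3)) 1 ×
      Metric.sphere (0 : EuclideanSpace ℂ (Fin 3)) 1) :
    sphereAct (heisenbergMul s t) p = sphereAct s (sphereAct t p) := by
  have h := twistedAct_heisenbergMul s t (y := (p.1, p.2)) (inner_self_eq_one_of_mem_sphere p.1.2)
  exact Prod.ext (Subtype.ext (congrArg Prod.fst h)) (Subtype.ext (congrArg Prod.snd h))

theorem sphereAct_zero (p : Metric.sphere (0 : EuclideanSpace ℂ (Fin 3)) 1 ×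
    Metric.sphere (0 : EuclideanSpace ℂ (Fin 3)) 1) : sphereAct 0 p = p := by
  have h := twistedAct_zero (y := (p.1, p.2)) (inner_self_eq_one_of_mem_sphere p.1.2)
  exact Prod.ext (Subtype.ext (congrArg Prod.fst h)) (Subtype.ext (congrArg Prod.snd h))

theorem eq_zero_of_sphereAct_eq {t : Fin 3 × Fin 3 × Fin 3}
    {p : Metric.sphere (0 : EuclideanSpace ℂ (Fin 3)) 1 ×
      Metric.sphere (0 : EuclideanSpace ℂ (Fin 3)) 1} (h : sphereAct t p = p) : t = 0 :=
  eq_zero_of_twistedAct_eq (y := (p.1, p.2)) (inner_self_eq_one_of_mem_sphere p.1.2)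
    (ne_zero_of_mem_unit_sphere p.2)
    (Prod.ext (congrArg (fun q => (q.1 : EuclideanSpace ℂ (Fin 3))) h)
      (congrArg (fun q => (q.2 : EuclideanSpace ℂ (Fin 3))) h))

theorem contMDiff_sphereAct (t : Fin 3 × Fin 3 × Fin 3) {n : WithTop ℕ∞} :
    ContMDiff ((𝓡 5).prod (𝓡 5)) ((𝓡 5).prod (𝓡 5)) n (sphereAct t) := by
  have h1 : ContMDiff ((𝓡 5).prod (𝓡 5))
      𝓘(ℝ, EuclideanSpace ℂ (Fin 3) × EuclideanSpace ℂ (Fin 3)) n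
      (fun p : Metric.sphere (0 : EuclideanSpace ℂ (Fin 3)) 1 ×
        Metric.sphere (0 : EuclideanSpace ℂ (Fin 3)) 1 =>
        ((p.1, p.2) : EuclideanSpace ℂ (Fin 3) × EuclideanSpace ℂ (Fin 3))) :=
    (contMDiff_coe_sphere.comp contMDiff_fst).prodMk_space
      (contMDiff_coe_sphere.comp contMDiff_snd)
  have h2 : ContMDiff ((𝓡 5).prod (𝓡 5))
      𝓘(ℝ, EuclideanSpace ℂ (Fin 3) × EuclideanSpace ℂ (Fin 3)) n
      (fun p : Metric.sphere (0 : EuclideanSpace ℂ (Fin 3)) 1 ×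
        Metric.sphere (0 : EuclideanSpace ℂ (Fin 3)) 1 => twistedAct t (p.1, p.2)) := fun p =>
    ContMDiffAt.comp p (contDiffAt_twistedAct t (y := (p.1, p.2))
      (inner_self_eq_one_of_mem_sphere p.1.2)).contMDiffAt (h1 p)
  exact ContMDiff.prodMk
    (ContMDiff.codRestrict_sphere (contDiff_fst.contMDiff.comp h2) _)
    (ContMDiff.codRestrict_sphere (contDiff_snd.contMDiff.comp h2) _)

theorem extraspecial_3_group_acts_freely_smoothly_on_S5xS5
    (G : Type) [Group G] [Fintype G]
    (hcard : Fintype.card G = 27)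
    (hnonab : ∃ g h : G, g * h ≠ h * g)
    (hexp : ∀ g : G, g ^ 3 = 1) :
    ∃ ρ : G → Diffeomorph ((𝓡 5).prod (𝓡 5)) ((𝓡 5).prod (𝓡 5))
        ((Metric.sphere (0 : EuclideanSpace ℂ (Fin 3)) 1) × (Metric.sphere (0 : EuclideanSpace ℂ (Fin 3)) 1))
        ((Metric.sphere (0 : EuclideanSpace ℂ (Fin 3)) 1) × (Metric.sphere (0 : EuclideanSpace ℂ (Fin 3)) 1)) (⊤ : ℕ∞),
      (∀ g h : G, ∀ x, ρ (g * h) x = ρ g (ρ h x)) ∧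
      (∀ g : G, g ≠ 1 → ∀ x, ρ g x ≠ x) := by
  obtain ⟨F, hmul, hone⟩ := exists_heisenberg_coordinates G hcard hnonab hexp
  have hinv : ∀ g h : G, g * h = 1 → ∀ x, sphereAct (F g) (sphereAct (F h) x) = x := by
    intro g h hgh x
    rw [← sphereAct_heisenbergMul, ← hmul, (hone _).2 hgh, sphereAct_zero]
  refine ⟨fun g =>
    { toFun := sphereAct (F g)
      invFun := sphereAct (F g⁻¹)
      left_inv := hinv _ _ (inv_mul_cancel g)
      right_inv := hinv _ _ (mul_inv_cancel g)
      contMDiff_toFun := contMDiff_sphereAct _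
      contMDiff_invFun := contMDiff_sphereAct _ }, fun g h x => ?_, fun g hg x hx => ?_⟩
  · change sphereAct (F (g * h)) x = _
    rw [hmul, sphereAct_heisenbergMul]
    rfl
  · exact hg ((hone g).1 (eq_zero_of_sphereAct_eq hx))
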